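/- arXiv:2001.02805 — 2 statements merged into one kernel-verified Lean document; each statement's English description precedes it below -/
import Mathlib

section
/- Abstract duality identity (the heart of the supercloseness Lemma for the velocity): Let Σ and V be real inner product spaces. Let A : Σ → Σ, D : Σ → V, B : Σ → V and C : V → V be linear maps, with A and C self-adjoint (⟨Aτ₁, τ₂⟩ = ⟨τ₁, Aτ₂⟩ for all τ₁, τ₂ ∈ Σ and ⟨Cv, w⟩ = ⟨v, Cw⟩ for all v, w ∈ V). Let Σ_h ⊆ Σ and V_h ⊆ V be subspaces, and let P : V → V be the orthogonal projection onto V_h (Pv ∈ V_h and ⟨v − Pv, w⟩ = 0 for all v ∈ V, w ∈ V_h). Let σ, σ̃ ∈ Σ, u, ũ ∈ V, σ_h ∈ Σ_h, u_h ∈ V_h, and let Π σ̃ ∈ Σ_h be an element with D(Π σ̃) = P(D σ̃). Set e := P u − u_h. Assume: (i) ⟨A(σ − σ_h), τ⟩ + ⟨Dτ, u − u_h⟩ = 0 for all τ ∈ Σ_h; (ii) −⟨D(σ − σ_h), v⟩ + ⟨B(σ − σ_h), v⟩ + ⟨C(u − u_h), v⟩ = 0 for all v ∈ V_h; (iii)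 ⟨A σ̃, σ − σ_h⟩ + ⟨D(σ − σ_h), ũ⟩ − ⟨B(σ − σ_h), ũ⟩ = 0; (iv) −⟨D σ̃, e⟩ + ⟨C ũ, e⟩ = ‖e‖². Then ‖e‖² = ⟨A(σ − σ_h), Π σ̃ − σ̃⟩ − ⟨D(σ − σ_h), ũ − P ũ⟩ + ⟨B(σ − σ_h), ũ − P ũ⟩ + ⟨C(u − u_h), ũ − P ũ⟩ + ⟨C ũ − P(C ũ), P u − u⟩. -/
open RealInnerProductSpace

/-- Abstract duality identity at the heart of the supercloseness lemma for the velocity: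
the exact error representation for the mixed discretization of the Oseen equation. -/
theorem stmt_14
    {E F : Type*} [NormedAddCommGroup E] [InnerProductSpace ℝ E]
    [NormedAddCommGroup F] [InnerProductSpace ℝ F]
    (A : E →ₗ[ℝ] E) (D : E →ₗ[ℝ] F) (B : E →ₗ[ℝ] F) (C : F →ₗ[ℝ] F)
    (hA : ∀ τ₁ τ₂ : E, ⟪A τ₁, τ₂⟫ = ⟪τ₁, A τ₂⟫)
    (hC : ∀ v w : F, ⟪C v, w⟫ = ⟪v, C w⟫)
    (Sh : Submodule ℝ E) (Vh : Submodule ℝ F)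
    (P : F →ₗ[ℝ] F)
    (hPmem : ∀ v : F, P v ∈ Vh)
    (hPortho : ∀ v : F, ∀ w ∈ Vh, ⟪v - P v, w⟫ = 0)
    (σ σt Pσt : E) (u ut : F) (σh : E) (uh : F)
    (hσh : σh ∈ Sh) (huh : uh ∈ Vh) (hP1 : Pσt ∈ Sh)
    (hcom : D Pσt = P (D σt))
    (e : F) (he : e = P u - uh)
    (h1 : ∀ τ ∈ Sh, ⟪A (σ - σh), τ⟫ + ⟪D τ, u - uh⟫ = 0)
    (h2 : ∀ v ∈ Vh, -⟪D (σ - σh), v⟫ + ⟪B (σ - σh), v⟫ + ⟪C (u - uh), v⟫ = 0)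
    (h3 : ⟪A σt, σ - σh⟫ + ⟪D (σ - σh), ut⟫ - ⟪B (σ - σh), ut⟫ = 0)
    (h4 : -⟪D σt, e⟫ + ⟪C ut, e⟫ = ‖e‖ ^ 2) :
    ‖e‖ ^ 2 = ⟪A (σ - σh), Pσt - σt⟫ - ⟪D (σ - σh), ut - P ut⟫
      + ⟪B (σ - σh), ut - P ut⟫ + ⟪C (u - uh), ut - P ut⟫
      + ⟪C ut - P (C ut), P u - u⟫ := by
  have he_mem : e ∈ Vh := he ▸ Vh.sub_mem (hPmem u) huh
  have hw : u - uh = e - (P u - u) := by rw [he]; abel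
  have hperp : ∀ v ∈ Vh, ⟪v, P u - u⟫ = 0 := fun v hv => by
    rw [real_inner_comm, ← neg_sub, inner_neg_left, hPortho u v hv, neg_zero]
  have hDσt := hPortho (D σt) e he_mem
  have hσ := h1 Pσt hP1
  have hu := h2 (P ut) (hPmem ut)
  have hDperp := hperp _ (hPmem (D σt))
  have hCperp := hperp _ (hPmem (C ut))
  have hAsymm : ⟪A σt, σ - σh⟫ = ⟪A (σ - σh), σt⟫ := by
    rw [hA, real_inner_comm]
  have hCsymm : ⟪C (u - uh), ut⟫ = ⟪C ut, e⟫ - ⟪C ut, P u - u⟫ := by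
    rw [hC, real_inner_comm, ← inner_sub_right, hw]
  rw [hcom] at hσ
  have hsplit : ⟪P (D σt), u - uh⟫ = ⟪P (D σt), e⟫ - ⟪P (D σt), P u - u⟫ := by
    rw [← inner_sub_right, hw]
  rw [inner_sub_left] at hDσt
  rw [inner_sub_right (A (σ - σh)), inner_sub_right (D (σ - σh)),
    inner_sub_right (B (σ - σh)), inner_sub_right (C (u - uh)), inner_sub_left (C ut)]
  linarith
end

section
/- Abstract improved discrete Poincaré inequality (the heart of Lemma 3.1): Let H and V be real inner product spaces, let A : H → H be linear, self-adjoint (⟨Aτ₁, τ₂⟩ = ⟨τ₁, Aτ₂⟩ for all τ₁, τ₂ ∈ H) and idempotent (A(Aτ) = Aτ for all τ ∈ H), and let D : H → V be linear. Let Σ_h ⊆ H be a subspace and set Z_h := {z ∈ Σ_h : Dz = 0}. Suppose τ_h ∈ Σ_h is Λ-orthogonal to Z_h, i.e. ⟨Aτ_h, z⟩ + ⟨Dτ_h, Dz⟩ = 0 for all z ∈ Z_h, and suppose ρ ∈ Σ_h satisfies Dρ = Dτ_h. Then ⟨Aτ_h, τ_h⟩ ≤ ‖ρ‖², i.e. the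 A-seminorm of τ_h is bounded by the norm of any element of Σ_h with the same image under D. -/
open RealInnerProductSpace

/-- Abstract improved discrete Poincaré inequality: if `A` is self-adjoint and idempotent,
`τ_h ∈ Σ_h` is `Λ`-orthogonal to the discrete kernel `Z_h = {z ∈ Σ_h : D z = 0}`, and
`ρ ∈ Σ_h` has the same image under `D` as `τ_h`, then `⟨A τ_h, τ_h⟩ ≤ ‖ρ‖²`. -/
theorem stmt_15
    {H V : Type*} [NormedAddCommGroup H] [InnerProductSpace ℝ H]
    [NormedAddCommGroup V] [InnerProductSpace ℝ V]
    (A : H →ₗ[ℝ] H) (D : H →ₗ[ℝ] V)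
    (hAsa : ∀ τ₁ τ₂ : H, ⟪A τ₁, τ₂⟫ = ⟪τ₁, A τ₂⟫)
    (hAid : ∀ τ : H, A (A τ) = A τ)
    (Sh : Submodule ℝ H)
    (τh : H) (hτh : τh ∈ Sh)
    (horth : ∀ z ∈ Sh, D z = 0 → ⟪A τh, z⟫ + ⟪D τh, D z⟫ = 0)
    (ρ : H) (hρ : ρ ∈ Sh) (hDρ : D ρ = D τh) :
    ⟪A τh, τh⟫ ≤ ‖ρ‖ ^ 2 := by
  have hz := horth (τh - ρ) (Sh.sub_mem hτh hρ) (by rw [map_sub, hDρ, sub_self])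
  rw [map_sub, hDρ, sub_self, inner_zero_right, add_zero, inner_sub_right] at hz
  have hA : ⟪A τh, τh⟫ = ‖A τh‖ ^ 2 := by
    rw [← real_inner_self_eq_norm_sq, ← hAsa, hAid]
  have hsq := norm_sub_sq_real (A τh) ρ
  linarith [sq_nonneg ‖A τh - ρ‖]
end
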